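/- arXiv:1911.06417 — 3 statements merged into one kernel-verified Lean document; each statement's English description precedes it below -/
import Mathlib

section
/- Let α ∈ {0,1}^n be a nonzero vector, let I_α be the ideal of S generated by the variables x_i with α_i = 1, and let x^α = x_1^{α_1}⋯x_n^{α_n}. Then for every e ≥ 0 and q = p^e, the colon ideal (I_α^{[q]} :_S I_α) equals I_α^{[q]} + ((x^α)^{q-1}), the sum of the q-th Frobenius power of I_α and the principal ideal generated by (x^α)^{q-1}. -/
/-!
Statement 0: For a nonzero vector `α ∈ {0,1}^n`, the face ideal `I_α ⊆ S = k[[x_1,…,x_n]]`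
satisfies `(I_α^{[q]} :_S I_α) = I_α^{[q]} + ((x^α)^{q-1})` for every `q = p^e`.
-/

noncomputable section

/-- The `q`-th Frobenius power of an ideal: the ideal generated by `{f^q : f ∈ I}`. -/
def frobPow {R : Type*} [CommRing R] (q : ℕ) (I : Ideal R) : Ideal R :=
  Ideal.span ((fun f => f ^ q) '' (I : Set R))

/-- The monomial `x^γ = x_1^{γ_1} ⋯ x_n^{γ_n}` in `k[[x_1,…,x_n]]`. -/
def mon (k : Type*) [Field k] {n : ℕ} (γ : Fin n → ℕ) : MvPowerSeries (Fin n) k :=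
  ∏ i, (MvPowerSeries.X i : MvPowerSeries (Fin n) k) ^ γ i

/-- The face ideal `I_α`, generated by the variables `x_i` with `α i = 1`. -/
def faceIdeal (k : Type*) [Field k] {n : ℕ} (α : Fin n → ℕ) :
    Ideal (MvPowerSeries (Fin n) k) :=
  Ideal.span {f | ∃ i, α i = 1 ∧ f = MvPowerSeries.X i}

theorem frobPow_span {R : Type*} [CommRing R] (p : ℕ) [ExpChar R p] (e : ℕ) (s : Set R) :
    frobPow (p ^ e) (Ideal.span s) = Ideal.span ((fun f => f ^ p ^ e) '' s) :=
  Ideal.map_span (iterateFrobenius R p e) s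

theorem MvPowerSeries.mem_span_X_pow_iff {σ R : Type*} [Finite σ] [CommRing R] {A : Set σ} {q : ℕ}
    {f : MvPowerSeries σ R} :
    f ∈ Ideal.span ((fun i => (MvPowerSeries.X i : MvPowerSeries σ R) ^ q) '' A) ↔
      ∀ d : σ →₀ ℕ, (∀ i ∈ A, d i < q) → MvPowerSeries.coeff d f = 0 := by
  classical
  constructor
  · intro hf d hd
    induction hf using Submodule.span_induction generalizing d with
    | mem x hx =>
      obtain ⟨i, hi, rfl⟩ := hx
      exact MvPowerSeries.X_pow_dvd_iff.1 dvd_rfl d (hd i hi)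
    | zero => simp
    | add x y _ _ hx hy => simp [hx d hd, hy d hd]
    | smul a x _ hx =>
      rw [smul_eq_mul, MvPowerSeries.coeff_mul]
      refine Finset.sum_eq_zero fun m hm => ?_
      rw [hx m.2 fun i hi => ?_, mul_zero]
      have h : m.1 i + m.2 i = d i := by
        rw [← Finset.HasAntidiagonal.mem_antidiagonal.1 hm, Finsupp.add_apply]
      have := hd i hi
      omega
  · intro h
    have := Fintype.ofFinite σ
    have hex (d : σ →₀ ℕ) : ∃ i : Option σ, MvPowerSeries.coeff d f ≠ 0 →
        ∃ j ∈ A, q ≤ d j ∧ i = some j := by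
      by_cases hd : MvPowerSeries.coeff d f = 0
      · exact ⟨none, fun h' => absurd hd h'⟩
      · have : ∃ j ∈ A, q ≤ d j := by
          by_contra! hlt
          exact hd (h d hlt)
        obtain ⟨j, hj, hq⟩ := this
        exact ⟨some j, fun _ => ⟨j, hj, hq, rfl⟩⟩
    choose c hc using hex
    let g (i : σ) : MvPowerSeries σ R := fun m =>
      if c (m + Finsupp.single i q) = some i then
        MvPowerSeries.coeff (m + Finsupp.single i q) f else 0
    have hg (i : σ) (m : σ →₀ ℕ) : MvPowerSeries.coeff m (g i) =
      if c (m + Finsupp.single i q) = some i then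
        MvPowerSeries.coeff (m + Finsupp.single i q) f else 0 := rfl
    have hf : f = ∑ i with i ∈ A, g i * MvPowerSeries.X i ^ q := by
      ext d
      have hcoeff (i : σ) : MvPowerSeries.coeff d (g i * MvPowerSeries.X i ^ q) =
          if q ≤ d i ∧ c d = some i then MvPowerSeries.coeff d f else 0 := by
        rw [MvPowerSeries.X_pow_eq, MvPowerSeries.coeff_mul_monomial, mul_one, hg]
        by_cases hq : Finsupp.single i q ≤ d
        · have hq' : q ≤ d i := by simpa using hq
          simp [hq, hq', tsub_add_cancel_of_le]
        · have hq' : ¬ q ≤ d i := by simpa using hq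
          simp [hq, hq']
      simp only [map_sum, hcoeff]
      by_cases hd : MvPowerSeries.coeff d f = 0
      · simp [hd]
      · obtain ⟨j, hj, hq, hcj⟩ := hc d hd
        rw [Finset.sum_eq_single j]
        · simp [hq, hcj]
        · intro b _ hb
          rw [if_neg]
          rintro ⟨-, h'⟩
          exact hb (Option.some_injective _ (h'.symm.trans hcj))
        · simp [hj]
    rw [hf]
    exact Ideal.sum_mem _ fun i hi => Ideal.mul_mem_left _ _ <|
      Ideal.subset_span ⟨i, (Finset.mem_filter.1 hi).2, rfl⟩

theorem mon_eq_monomial (k : Type*) [Field k] {n : ℕ} (γ : Fin n → ℕ) :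
    mon k γ = MvPowerSeries.monomial (Finsupp.equivFunOnFinite.symm γ) 1 := by
  simp only [mon, MvPowerSeries.X_pow_eq, MvPowerSeries.prod_monomial, Finset.prod_const_one]
  congr 2
  exact (Finsupp.equivFunOnFinite_symm_eq_sum γ).symm

theorem statement0 (p : ℕ) [Fact p.Prime] (k : Type*) [Field k] [CharP k p]
    (n : ℕ) (hn : 0 < n) (α : Fin n → ℕ)
    (hα01 : ∀ i, α i = 0 ∨ α i = 1) (hα : α ≠ 0) (e : ℕ) :
    (frobPow (p ^ e) (faceIdeal k α)).colon (faceIdeal k α) =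
      frobPow (p ^ e) (faceIdeal k α) ⊔ Ideal.span {mon k α ^ (p ^ e - 1)} := by
  classical
  have : CharP (MvPowerSeries (Fin n) k) p :=
    charP_of_injective_ringHom MvPowerSeries.C_injective p
  have : ExpChar (MvPowerSeries (Fin n) k) p := ExpChar.prime Fact.out
  have hq : 0 < p ^ e := pow_pos (Fact.out : p.Prime).pos e
  have hface : faceIdeal k α = Ideal.span (MvPowerSeries.X '' {i | α i = 1}) := by
    rw [faceIdeal]
    congr 1
    ext f
    simp [eq_comm]
  have hfrob : frobPow (p ^ e) (faceIdeal k α) = Ideal.span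
      ((fun i => (MvPowerSeries.X i : MvPowerSeries (Fin n) k) ^ p ^ e) '' {i | α i = 1}) := by
    rw [hface, frobPow_span, Set.image_image]
  rw [hfrob]
  generalize p ^ e = q at hq
  apply le_antisymm
  · intro f hf
    have hvanish (d : Fin n →₀ ℕ) (hd : ∀ i, α i = 1 → d i < q) (j : Fin n) (hj : α j = 1)
        (hdj : d j + 1 < q) : MvPowerSeries.coeff d f = 0 := by
      have hmem := Submodule.mem_colon.1 hf (MvPowerSeries.X j)
        (Ideal.subset_span ⟨j, hj, rfl⟩)
      have := MvPowerSeries.mem_span_X_pow_iff.1 hmem (d + Finsupp.single j 1) fun i hi => by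
        rcases eq_or_ne i j with rfl | hij
        · simpa using hdj
        · simpa [Finsupp.single_apply, hij.symm] using hd i hi
      rwa [smul_eq_mul, MvPowerSeries.X_def, MvPowerSeries.coeff_add_mul_monomial,
        mul_one] at this
    rw [mon_eq_monomial, MvPowerSeries.monomial_pow, one_pow]
    set s := (q - 1) • Finsupp.equivFunOnFinite.symm α with hs
    have hsi (i : Fin n) : s i = (q - 1) * α i := by simp [hs]
    let g : MvPowerSeries (Fin n) k := fun m => MvPowerSeries.coeff (m + s) f
    have hg (m : Fin n →₀ ℕ) : MvPowerSeries.coeff m g = MvPowerSeries.coeff (m + s) f := rfl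
    rw [← sub_add_cancel f (g * MvPowerSeries.monomial s 1)]
    refine Submodule.add_mem_sup (MvPowerSeries.mem_span_X_pow_iff.2 fun d hd => ?_)
      (Ideal.mul_mem_left _ _ (Ideal.mem_span_singleton_self _))
    rw [map_sub, MvPowerSeries.coeff_mul_monomial, hg, mul_one]
    by_cases hsd : s ≤ d
    · rw [if_pos hsd, tsub_add_cancel_of_le hsd, sub_self]
    · rw [if_neg hsd, sub_zero]
      obtain ⟨j, hj⟩ : ∃ j, d j < s j := by
        simpa [Finsupp.le_def] using hsd
      rw [hsi] at hj
      rcases hα01 j with h0 | h1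
      · simp [h0] at hj
      · rw [h1] at hj
        exact hvanish d hd j h1 (by omega)
  · refine sup_le Ideal.le_colon ?_
    rw [Ideal.span_singleton_le_iff_mem, Submodule.mem_colon]
    intro f hf
    rw [SetLike.mem_coe, hface] at hf
    induction hf using Submodule.span_induction with
    | mem x hx =>
      obtain ⟨j, hj, rfl⟩ := hx
      have hdvd : (MvPowerSeries.X j : MvPowerSeries (Fin n) k) ∣ mon k α := by
        have := Finset.dvd_prod_of_mem
          (fun i => (MvPowerSeries.X i : MvPowerSeries (Fin n) k) ^ α i) (Finset.mem_univ j)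
        rwa [show α j = 1 from hj, pow_one] at this
      refine Ideal.mem_of_dvd _ ?_ (Ideal.subset_span ⟨j, hj, rfl⟩)
      have := mul_dvd_mul_right (pow_dvd_pow_of_dvd hdvd (q - 1)) (MvPowerSeries.X j)
      rwa [← pow_succ, Nat.sub_add_cancel hq] at this
    | zero => simp
    | add x y _ _ hx hy => rw [smul_add]; exact add_mem hx hy
    | smul a x _ hx => rw [smul_comm]; exact Submodule.smul_mem _ a hx

end
end

section
/- Let I ⊆ S be a squarefree monomial ideal with minimal primary decomposition I = I_{α_1} ∩ ⋯ ∩ I_{α_r}. Then for every e ≥ 0 and q = p^e, (I^{[q]} :_S I) = (I_{α_1}^{[q]} :_S I_{α_1}) ∩ ⋯ ∩ (I_{α_r}^{[q]} :_S I_{α_r}). -/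
noncomputable section

/-- `I = I_{α_1} ∩ ⋯ ∩ I_{α_r}` is the minimal primary decomposition of the squarefree
monomial ideal `I` into face ideals: each `α j` is a nonzero `{0,1}`-vector, `I` is the
intersection of the face ideals `I_{α j}`, and the decomposition is irredundant (the
supports of the `α j` are pairwise incomparable). -/
def IsMinFaceDecomp (k : Type*) [Field k] {n r : ℕ} (α : Fin r → Fin n → ℕ)
    (I : Ideal (MvPowerSeries (Fin n) k)) : Prop :=
  (∀ j i, α j i = 0 ∨ α j i = 1) ∧ (∀ j, α j ≠ 0) ∧
    I = ⨅ j, faceIdeal k (α j) ∧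
    ∀ j l, j ≠ l → ¬ ({i | α j i = 1} ⊆ {i | α l i = 1})

section MonomialIdeals

open MvPowerSeries

variable {σ R : Type*} [CommRing R]

/-- A power series is divisible by a monomial if every exponent of its support is. -/
theorem MvPowerSeries.monomial_dvd_of_le (s : σ →₀ ℕ) (f : MvPowerSeries σ R)
    (h : ∀ m, coeff m f ≠ 0 → s ≤ m) : monomial s (1 : R) ∣ f := by
  classical
  let g : MvPowerSeries σ R := fun m => coeff (s + m) f
  have hg : ∀ m, coeff m g = coeff (s + m) f := fun _ => rfl
  refine ⟨g, ?_⟩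
  ext m
  rw [coeff_monomial_mul]
  split_ifs with hs
  · rw [one_mul, hg, add_tsub_cancel_of_le hs]
  · by_contra hm
    exact hs (h m hm)

/-- Membership in an ideal generated by finitely many monomials is detected on the support. -/
theorem MvPowerSeries.mem_span_monomial_iff (F : Finset (σ →₀ ℕ)) (f : MvPowerSeries σ R) :
    f ∈ Ideal.span ((fun s => monomial s (1 : R)) '' (F : Set (σ →₀ ℕ))) ↔
      ∀ m, coeff m f ≠ 0 → ∃ s ∈ F, s ≤ m := by
  classical
  constructor
  · intro hf
    induction hf using Submodule.span_induction with
    | mem x hx =>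
      obtain ⟨s, hs, rfl⟩ := hx
      intro m hm
      refine ⟨s, hs, ?_⟩
      dsimp only at hm
      rw [coeff_monomial] at hm
      by_contra hsm
      exact hm (if_neg fun h => hsm h.ge)
    | zero => simp
    | add x y _ _ hx hy =>
      intro m hm
      by_cases hxm : coeff m x = 0
      · exact hy m fun hym => hm (by rw [map_add, hxm, hym, add_zero])
      · exact hx m hxm
    | smul a x _ hx =>
      intro m hm
      rw [smul_eq_mul, coeff_mul] at hm
      obtain ⟨⟨u, v⟩, huv, hne⟩ := Finset.exists_ne_zero_of_sum_ne_zero hm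
      obtain ⟨s, hs, hsv⟩ := hx v (right_ne_zero_of_mul hne)
      rw [Finset.HasAntidiagonal.mem_antidiagonal] at huv
      exact ⟨s, hs, hsv.trans (huv ▸ le_add_self)⟩
  · intro h
    choose! c hcF hcle using h
    let g : (σ →₀ ℕ) → MvPowerSeries σ R := fun s m => if c m = s then coeff m f else 0
    have hg : ∀ s m, coeff m (g s) = if c m = s then coeff m f else 0 := fun _ _ => rfl
    have hsum : f = ∑ s ∈ F, g s := by
      ext m
      rw [map_sum]
      simp only [hg, Finset.sum_ite_eq]
      split_ifs with hm
      · rfl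
      · by_contra hne
        exact hm (hcF m hne)
    rw [hsum]
    refine Ideal.sum_mem _ fun s hs => ?_
    refine Ideal.mem_of_dvd _ (monomial_dvd_of_le s (g s) fun m hm => ?_)
      (Ideal.subset_span ⟨s, hs, rfl⟩)
    rw [hg] at hm
    split_ifs at hm with hc
    · exact hc ▸ hcle m hm
    · exact absurd rfl hm

end MonomialIdeals

section FrobeniusPowers

theorem frobPow_mono {R : Type*} [CommRing R] (q : ℕ) {I J : Ideal R} (h : I ≤ J) :
    frobPow q I ≤ frobPow q J :=
  Ideal.span_mono (Set.image_mono h)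

theorem frobPow_eq_map {R : Type*} [CommRing R] (p e : ℕ) [ExpChar R p] (I : Ideal R) :
    frobPow (p ^ e) I = I.map (iterateFrobenius R p e) :=
  rfl

open MvPowerSeries

variable {k : Type*} [Field k] {n : ℕ}

instance (p : ℕ) [CharP k p] : CharP (MvPowerSeries (Fin n) k) p :=
  charP_of_injective_ringHom (f := (C : k →+* MvPowerSeries (Fin n) k)) C_injective p

theorem faceIdeal_eq_span_image (α : Fin n → ℕ) :
    faceIdeal k α = Ideal.span ((fun i => (X i : MvPowerSeries (Fin n) k)) '' {i | α i = 1}) := by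
  rw [faceIdeal]
  congr 1
  ext f
  simp [eq_comm]

theorem mem_frobPow_faceIdeal (p : ℕ) [Fact p.Prime] [CharP k p] (e : ℕ) (α : Fin n → ℕ)
    (f : MvPowerSeries (Fin n) k) :
    f ∈ frobPow (p ^ e) (faceIdeal k α) ↔
      ∀ m, coeff m f ≠ 0 → ∃ i, α i = 1 ∧ p ^ e ≤ m i := by
  classical
  have hspan : frobPow (p ^ e) (faceIdeal k α) =
      Ideal.span ((fun s => monomial s (1 : k)) ''
        (((Finset.univ.filter fun i => α i = 1).image fun i => Finsupp.single i (p ^ e) :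
          Finset (Fin n →₀ ℕ)) : Set (Fin n →₀ ℕ))) := by
    rw [frobPow_eq_map, faceIdeal_eq_span_image, Ideal.map_span, Finset.coe_image,
      Set.image_image, Set.image_image]
    simp [iterateFrobenius_def, X_pow_eq]
  rw [hspan, mem_span_monomial_iff]
  simp

theorem mem_faceIdeal (α : Fin n → ℕ) (f : MvPowerSeries (Fin n) k) :
    f ∈ faceIdeal k α ↔ ∀ m, coeff m f ≠ 0 → ∃ i, α i = 1 ∧ 1 ≤ m i := by
  classical
  have hspan : faceIdeal k α =
      Ideal.span ((fun s => monomial s (1 : k)) ''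
        (((Finset.univ.filter fun i => α i = 1).image fun i => Finsupp.single i 1 :
          Finset (Fin n →₀ ℕ)) : Set (Fin n →₀ ℕ))) := by
    rw [faceIdeal_eq_span_image, Finset.coe_image, Set.image_image]
    simp [X_def]
  rw [hspan, mem_span_monomial_iff]
  simp

/-- The squarefree monomial with support `A` lies in every face ideal whose support meets `A`. -/
theorem monomial_indicator_mem_faceIdeal (A : Finset (Fin n)) {α : Fin n → ℕ}
    (h : ∃ i ∈ A, α i = 1) :
    monomial (Finsupp.indicator A fun _ _ => 1) (1 : k) ∈ faceIdeal k α := by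
  classical
  obtain ⟨i, hiA, hi⟩ := h
  rw [mem_faceIdeal]
  intro m hm
  rw [coeff_monomial] at hm
  split_ifs at hm with h
  · exact ⟨i, hi, by simp [h, hiA]⟩
  · exact absurd rfl hm

/-- Frobenius powers commute with finite intersections of face ideals. -/
theorem frobPow_iInf_faceIdeal (p : ℕ) [Fact p.Prime] [CharP k p] (e : ℕ) {r : ℕ}
    (α : Fin r → Fin n → ℕ) :
    frobPow (p ^ e) (⨅ j, faceIdeal k (α j)) = ⨅ j, frobPow (p ^ e) (faceIdeal k (α j)) := by
  classical
  refine le_antisymm (le_iInf fun j => frobPow_mono _ (iInf_le _ j)) fun f hf => ?_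
  simp only [Ideal.mem_iInf, mem_frobPow_faceIdeal] at hf
  let F : Finset (Fin n →₀ ℕ) :=
    (Finset.univ.filter fun A : Finset (Fin n) => ∀ j, ∃ i ∈ A, α j i = 1).image
      fun A => Finsupp.indicator A fun _ _ => p ^ e
  have hfF : f ∈ Ideal.span ((fun s => monomial s (1 : k)) '' (F : Set (Fin n →₀ ℕ))) := by
    rw [mem_span_monomial_iff]
    intro m hm
    refine ⟨Finsupp.indicator (Finset.univ.filter fun i => p ^ e ≤ m i) fun _ _ => p ^ e,
      Finset.mem_image_of_mem _ ?_, fun i => ?_⟩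
    · simp only [Finset.mem_filter, Finset.mem_univ, true_and]
      intro j
      obtain ⟨i, hi, him⟩ := hf j m hm
      exact ⟨i, him, hi⟩
    · rw [Finsupp.indicator_apply]
      split_ifs with h
      · exact (Finset.mem_filter.mp h).2
      · exact Nat.zero_le _
  refine Ideal.span_le.mpr ?_ hfF
  rintro _ ⟨s, hs, rfl⟩
  obtain ⟨A, hA, rfl⟩ := Finset.mem_image.mp hs
  refine Ideal.subset_span ⟨monomial (Finsupp.indicator A fun _ _ => 1) (1 : k), ?_, ?_⟩
  · simp only [SetLike.mem_coe, Ideal.mem_iInf]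
    exact fun j => monomial_indicator_mem_faceIdeal A ((Finset.mem_filter.mp hA).2 j)
  · have hsmul : (p ^ e) • (Finsupp.indicator A fun _ _ => 1) =
        Finsupp.indicator A fun _ _ => p ^ e := by
      ext i
      simp [Finsupp.indicator_apply]
    change monomial _ (1 : k) ^ p ^ e = monomial _ 1
    rw [monomial_pow, one_pow, hsmul]

/-- Monomials in the variables off the support of `α` are nonzerodivisors modulo the Frobenius
powers of the face ideal of `α`. -/
theorem mem_frobPow_faceIdeal_of_monomial_mul_mem (p : ℕ) [Fact p.Prime] [CharP k p] (e : ℕ)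
    {α : Fin n → ℕ} {u : Fin n →₀ ℕ} (hu : ∀ i, α i = 1 → u i = 0)
    {f : MvPowerSeries (Fin n) k}
    (h : monomial u 1 * f ∈ frobPow (p ^ e) (faceIdeal k α)) :
    f ∈ frobPow (p ^ e) (faceIdeal k α) := by
  rw [mem_frobPow_faceIdeal] at h ⊢
  intro m hm
  obtain ⟨i, hi, him⟩ := h (u + m) (by rwa [coeff_add_monomial_mul, one_mul])
  exact ⟨i, hi, by simpa [hu i hi] using him⟩

end FrobeniusPowers

theorem statement1 (p : ℕ) [Fact p.Prime] (k : Type*) [Field k] [CharP k p]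
    (n : ℕ) (hn : 0 < n) (r : ℕ) (hr : 0 < r) (α : Fin r → Fin n → ℕ)
    (I : Ideal (MvPowerSeries (Fin n) k)) (hdec : IsMinFaceDecomp k α I) (e : ℕ) :
    (frobPow (p ^ e) I).colon I =
      ⨅ j, (frobPow (p ^ e) (faceIdeal k (α j))).colon (faceIdeal k (α j)) := by
  classical
  obtain ⟨-, -, rfl, hirr⟩ := hdec
  ext g
  simp only [Ideal.mem_iInf, Submodule.mem_colon, SetLike.mem_coe, smul_eq_mul,
    frobPow_iInf_faceIdeal]
  constructor
  · intro hg j x hx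
    let A : Finset (Fin n) := Finset.univ.filter fun i => α j i ≠ 1
    let u : Fin n →₀ ℕ := Finsupp.indicator A fun _ _ => 1
    refine mem_frobPow_faceIdeal_of_monomial_mul_mem p e (u := u) (fun i hi => ?_) ?_
    · simp [u, A, hi]
    · rw [mul_left_comm]
      refine hg _ (fun l => ?_) j
      by_cases hlj : l = j
      · subst hlj
        exact Ideal.mul_mem_left _ _ hx
      · refine Ideal.mul_mem_right _ _ (monomial_indicator_mem_faceIdeal A ?_)
        obtain ⟨i, hil, hij⟩ := Set.not_subset.mp (hirr l j hlj)
        exact ⟨i, Finset.mem_filter.mpr ⟨Finset.mem_univ i, hij⟩, hil⟩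
  · intro hg x hx j
    exact hg j x (hx j)

end
end

section
/- Let I ⊆ S be a squarefree monomial ideal with minimal primary decomposition I = I_{α_1} ∩ ⋯ ∩ I_{α_r}. Then for every e ≥ 0 and q = p^e, (I^{[q]} :_S I) = (I_{α_1}^{[q]} + ((x^{α_1})^{q-1})) ∩ ⋯ ∩ (I_{α_r}^{[q]} + ((x^{α_r})^{q-1})), where x^{α_i} = x_1^{α_{i1}}⋯x_n^{α_{in}}. -/
noncomputable section

namespace MonomialIdeal

open MvPowerSeries

variable {σ k : Type*} [Field k]

/-- The ideal of power series whose support lies in the upper set `U` of exponents. -/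
def ofUpperSet (k : Type*) [Field k] (U : Set (σ →₀ ℕ)) (hU : IsUpperSet U) :
    Ideal (MvPowerSeries σ k) where
  carrier := {f | ∀ m, coeff m f ≠ 0 → m ∈ U}
  add_mem' {f g} hf hg m hm := by
    by_cases h : coeff m f = 0
    · exact hg m fun h' => hm (by simp [h, h'])
    · exact hf m h
  zero_mem' m hm := absurd (map_zero _) hm
  smul_mem' a f hf m hm := by
    classical
    rw [smul_eq_mul, coeff_mul] at hm
    obtain ⟨x, hx, hne⟩ := Finset.exists_ne_zero_of_sum_ne_zero hm
    refine hU ?_ (hf x.2 (right_ne_zero_of_mul hne))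
    exact (Finset.HasAntidiagonal.mem_antidiagonal.mp hx) ▸ le_add_self

theorem mem_ofUpperSet {U : Set (σ →₀ ℕ)} {hU : IsUpperSet U} {f : MvPowerSeries σ k} :
    f ∈ ofUpperSet k U hU ↔ ∀ m, coeff m f ≠ 0 → m ∈ U :=
  Iff.rfl

theorem monomial_mem_ofUpperSet {U : Set (σ →₀ ℕ)} {hU : IsUpperSet U} {m : σ →₀ ℕ}
    (hm : m ∈ U) : monomial m (1 : k) ∈ ofUpperSet k U hU := fun _ h =>
  eq_of_coeff_monomial_ne_zero h ▸ hm

/-- A power series all of whose exponents are divisible by one of finitely many monomials of an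
ideal `J` lies in `J`. -/
theorem mem_of_forall_exists_le {J : Ideal (MvPowerSeries σ k)} (T : Finset (σ →₀ ℕ))
    (hT : ∀ t ∈ T, monomial t (1 : k) ∈ J) (f : MvPowerSeries σ k)
    (hf : ∀ m, coeff m f ≠ 0 → ∃ t ∈ T, t ≤ m) : f ∈ J := by
  classical
  induction T using Finset.induction_on generalizing f with
  | empty =>
    have : f = 0 := by
      ext m
      by_contra h
      obtain ⟨t, ht, -⟩ := hf m h
      simp at ht
    exact this ▸ J.zero_mem
  | insert t T _ ih =>
    let g : MvPowerSeries σ k := fun m => coeff (t + m) f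
    have hg : ∀ m, coeff m g = coeff (t + m) f := fun _ => rfl
    have hmul : monomial t 1 * g ∈ J := J.mul_mem_right _ (hT t (Finset.mem_insert_self _ _))
    suffices f - monomial t 1 * g ∈ J by simpa using J.add_mem this hmul
    refine ih (fun s hs => hT s (Finset.mem_insert_of_mem hs)) _ fun m hm => ?_
    rw [map_sub, coeff_monomial_mul, one_mul, hg] at hm
    split_ifs at hm with h
    · rw [add_tsub_cancel_of_le h, sub_self] at hm
      exact absurd rfl hm
    · rw [sub_zero] at hm
      obtain ⟨s, hs, hsm⟩ := hf m hm
      rcases Finset.mem_insert.mp hs with rfl | hs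
      · exact absurd hsm h
      · exact ⟨s, hs, hsm⟩

variable {n : ℕ}

/-- The exponents of the monomials in `I_α^{[q]}`. -/
def faceExponents (q : ℕ) (α : Fin n → ℕ) : Set (Fin n →₀ ℕ) :=
  {m | ∃ i, α i = 1 ∧ q ≤ m i}

theorem isUpperSet_faceExponents (q : ℕ) (α : Fin n → ℕ) :
    IsUpperSet (faceExponents q α) := by
  rintro a b hab ⟨i, hi, hq⟩
  exact ⟨i, hi, hq.trans (hab i)⟩

theorem faceIdeal_eq (α : Fin n → ℕ) :
    faceIdeal k α = ofUpperSet k (faceExponents 1 α) (isUpperSet_faceExponents 1 α) := by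
  classical
  apply le_antisymm
  · refine Ideal.span_le.mpr ?_
    rintro _ ⟨i, hi, rfl⟩
    exact monomial_mem_ofUpperSet ⟨i, hi, by simp⟩
  · intro f hf
    refine mem_of_forall_exists_le
      ((Finset.univ.filter fun i => α i = 1).image fun i => Finsupp.single i 1) ?_ f fun m hm => ?_
    · simp only [Finset.mem_image, Finset.mem_filter, Finset.mem_univ, true_and]
      rintro _ ⟨i, hi, rfl⟩
      exact Ideal.subset_span ⟨i, hi, rfl⟩
    · obtain ⟨i, hi, hmi⟩ := hf m hm
      exact ⟨_, Finset.mem_image_of_mem _ (by simpa using hi), by simpa using hmi⟩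

theorem frobPow_mono {R : Type*} [CommRing R] (q : ℕ) {I J : Ideal R} (h : I ≤ J) :
    frobPow q I ≤ frobPow q J :=
  Ideal.span_mono (Set.image_mono h)

theorem pow_mem_frobPow {R : Type*} [CommRing R] (q : ℕ) {I : Ideal R} {f : R} (h : f ∈ I) :
    f ^ q ∈ frobPow q I :=
  Ideal.subset_span ⟨f, h, rfl⟩

theorem frobPow_faceIdeal_le (p : ℕ) [Fact p.Prime] [CharP k p] (e : ℕ) (α : Fin n → ℕ) :
    frobPow (p ^ e) (faceIdeal k α) ≤
      ofUpperSet k (faceExponents (p ^ e) α) (isUpperSet_faceExponents _ α) := by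
  have : CharP (MvPowerSeries (Fin n) k) p :=
    charP_of_injective_ringHom (f := C (σ := Fin n) (R := k)) C_injective p
  refine Ideal.span_le.mpr ?_
  rintro _ ⟨f, hf, rfl⟩
  refine Submodule.span_induction (p := fun f _ => f ^ p ^ e ∈
    ofUpperSet k (faceExponents (p ^ e) α) (isUpperSet_faceExponents _ α)) ?_ ?_ ?_ ?_ hf
  · rintro _ ⟨i, hi, rfl⟩
    rw [X_pow_eq]
    exact monomial_mem_ofUpperSet ⟨i, hi, by simp⟩
  · rw [zero_pow (pow_ne_zero _ (Fact.out : p.Prime).ne_zero)]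
    exact Ideal.zero_mem _
  · intro x y _ _ hx hy
    rw [add_pow_char_pow]
    exact Ideal.add_mem _ hx hy
  · intro a x _ hx
    rw [smul_eq_mul, mul_pow]
    exact Ideal.mul_mem_left _ _ hx

theorem mon_pow_eq_monomial (γ : Fin n → ℕ) (q : ℕ) :
    mon k γ ^ q = monomial (q • Finsupp.equivFunOnFinite.symm γ) 1 := by
  have : mon k γ = monomial (Finsupp.equivFunOnFinite.symm γ) 1 := by
    rw [monomial_one_eq, Finsupp.prod_fintype _ _ (by simp)]
    rfl
  rw [this, monomial_pow, one_pow]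

/-- The exponents of the monomials in `I_α^{[q]} + ((x^α)^{q-1})`. -/
def colonExponents (q : ℕ) (α : Fin n → ℕ) : Set (Fin n →₀ ℕ) :=
  {m | m ∈ faceExponents q α ∨ ∀ i, α i = 1 → q - 1 ≤ m i}

theorem isUpperSet_colonExponents (q : ℕ) (α : Fin n → ℕ) :
    IsUpperSet (colonExponents q α) := by
  rintro a b hab (h | h)
  · exact Or.inl (isUpperSet_faceExponents q α hab h)
  · exact Or.inr fun i hi => (h i hi).trans (hab i)

theorem frobPow_faceIdeal_sup_span_eq (p : ℕ) [Fact p.Prime] [CharP k p] (e : ℕ)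
    {α : Fin n → ℕ} (hα : ∀ i, α i = 0 ∨ α i = 1) :
    frobPow (p ^ e) (faceIdeal k α) ⊔ Ideal.span {mon k α ^ (p ^ e - 1)} =
      ofUpperSet k (colonExponents (p ^ e) α) (isUpperSet_colonExponents _ α) := by
  classical
  rw [mon_pow_eq_monomial]
  apply le_antisymm
  · refine sup_le ((frobPow_faceIdeal_le p e α).trans fun f hf m hm => Or.inl (hf m hm)) ?_
    rw [Ideal.span_singleton_le_iff_mem]
    exact monomial_mem_ofUpperSet (Or.inr fun i hi => by simp [hi])
  · intro f hf
    refine mem_of_forall_exists_le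
      (insert ((p ^ e - 1) • Finsupp.equivFunOnFinite.symm α)
        ((Finset.univ.filter fun i => α i = 1).image fun i => Finsupp.single i (p ^ e)))
      ?_ f fun m hm => ?_
    · simp only [Finset.mem_insert, Finset.mem_image, Finset.mem_filter, Finset.mem_univ, true_and]
      rintro _ (rfl | ⟨i, hi, rfl⟩)
      · exact Ideal.mem_sup_right (Ideal.mem_span_singleton_self _)
      · rw [← X_pow_eq]
        exact Ideal.mem_sup_left (pow_mem_frobPow _ (Ideal.subset_span ⟨i, hi, rfl⟩))
    · rcases hf m hm with ⟨i, hi, hmi⟩ | h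
      · exact ⟨_, Finset.mem_insert_of_mem (Finset.mem_image_of_mem _ (by simpa using hi)),
          by simpa using hmi⟩
      · refine ⟨_, Finset.mem_insert_self _ _, fun i => ?_⟩
        rcases hα i with h0 | h1
        · simp [h0]
        · simpa [h1] using h i h1

variable {r : ℕ}

theorem mem_iInf_faceIdeal {α : Fin r → Fin n → ℕ} {f : MvPowerSeries (Fin n) k} :
    f ∈ ⨅ j, faceIdeal k (α j) ↔ ∀ j m, coeff m f ≠ 0 → m ∈ faceExponents 1 (α j) := by
  simp only [Ideal.mem_iInf, faceIdeal_eq, mem_ofUpperSet]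

theorem mem_frobPow_iInf_faceIdeal {α : Fin r → Fin n → ℕ} {q : ℕ}
    {f : MvPowerSeries (Fin n) k} (hf : ∀ m, coeff m f ≠ 0 → ∀ j, m ∈ faceExponents q (α j)) :
    f ∈ frobPow q (⨅ j, faceIdeal k (α j)) := by
  classical
  let ind : Finset (Fin n) → (Fin n →₀ ℕ) := fun s =>
    Finsupp.equivFunOnFinite.symm fun i => if i ∈ s then 1 else 0
  refine mem_of_forall_exists_le
    ((Finset.univ.filter fun s => ∀ j, ∃ i ∈ s, α j i = 1).image fun s => q • ind s)
    ?_ f fun m hm => ?_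
  · simp only [Finset.mem_image, Finset.mem_filter, Finset.mem_univ, true_and]
    rintro _ ⟨s, hs, rfl⟩
    have hpow : monomial (q • ind s) (1 : k) = monomial (ind s) 1 ^ q := by
      rw [monomial_pow, one_pow]
    rw [hpow]
    refine pow_mem_frobPow _ (mem_iInf_faceIdeal.mpr fun j m hm => ?_)
    obtain ⟨i, his, hi⟩ := hs j
    rw [eq_of_coeff_monomial_ne_zero hm]
    exact ⟨i, hi, by simp [ind, his]⟩
  · refine ⟨_, Finset.mem_image_of_mem _ (a := Finset.univ.filter fun i => q ≤ m i) ?_, fun i => ?_⟩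
    · simp only [Finset.mem_filter, Finset.mem_univ, true_and]
      intro j
      obtain ⟨i, hi, hq⟩ := hf m hm j
      exact ⟨i, hq, hi⟩
    · by_cases h : q ≤ m i <;> simp [ind, h]

theorem mem_colonExponents_of_mem_colon (p : ℕ) [Fact p.Prime] [CharP k p] (e : ℕ)
    {α : Fin r → Fin n → ℕ} (hirr : ∀ j l, j ≠ l → ¬ ({i | α j i = 1} ⊆ {i | α l i = 1}))
    {g : MvPowerSeries (Fin n) k}
    (hg : ∀ f ∈ ⨅ j, faceIdeal k (α j), g * f ∈ frobPow (p ^ e) (⨅ j, faceIdeal k (α j)))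
    (j : Fin r) {m : Fin n →₀ ℕ} (hm : coeff m g ≠ 0) :
    m ∈ colonExponents (p ^ e) (α j) := by
  classical
  by_contra hcon
  obtain ⟨hface, i, hi, hmi⟩ : m ∉ faceExponents (p ^ e) (α j) ∧
      ∃ i, α j i = 1 ∧ m i < p ^ e - 1 := by
    simpa only [colonExponents, Set.mem_ofPred_eq, not_or, not_forall, not_le, exists_prop] using hcon
  let b : Fin n →₀ ℕ :=
    Finsupp.equivFunOnFinite.symm fun t => if t = i ∨ α j t ≠ 1 then 1 else 0
  have hbI : monomial b (1 : k) ∈ ⨅ j, faceIdeal k (α j) := by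
    refine mem_iInf_faceIdeal.mpr fun l d hd => ?_
    rw [eq_of_coeff_monomial_ne_zero hd]
    by_cases hl : l = j
    · exact ⟨i, hl ▸ hi, by simp [b]⟩
    · obtain ⟨t, htl, htj⟩ := Set.not_subset.mp (hirr l j hl)
      have htj' : α j t ≠ 1 := htj
      exact ⟨t, htl, by simp [b, htj']⟩
  have hle : ⨅ j, faceIdeal k (α j) ≤ faceIdeal k (α j) := iInf_le _ j
  have hmem := frobPow_faceIdeal_le p e (α j) (frobPow_mono _ hle (hg _ hbI))
  have hcoeff : coeff (m + b) (g * monomial b 1) ≠ 0 := by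
    rwa [coeff_add_mul_monomial, mul_one]
  obtain ⟨t, ht, hqt⟩ := mem_ofUpperSet.mp hmem (m + b) hcoeff
  have hbt : b t = if t = i then 1 else 0 := by simp [b, ht]
  rw [Finsupp.add_apply, hbt] at hqt
  split_ifs at hqt with hti
  · subst hti
    omega
  · exact hface ⟨t, ht, hqt⟩

end MonomialIdeal

open MonomialIdeal MvPowerSeries

theorem statement2 (p : ℕ) [Fact p.Prime] (k : Type*) [Field k] [CharP k p]
    (n : ℕ) (hn : 0 < n) (r : ℕ) (hr : 0 < r) (α : Fin r → Fin n → ℕ)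
    (I : Ideal (MvPowerSeries (Fin n) k)) (hdec : IsMinFaceDecomp k α I) (e : ℕ) :
    (frobPow (p ^ e) I).colon I =
      ⨅ j, (frobPow (p ^ e) (faceIdeal k (α j)) ⊔
        Ideal.span {mon k (α j) ^ (p ^ e - 1)}) := by
  classical
  obtain ⟨h01, -, rfl, hirr⟩ := hdec
  simp only [frobPow_faceIdeal_sup_span_eq p e (h01 _)]
  ext g
  simp only [Submodule.mem_colon, smul_eq_mul, SetLike.mem_coe, Ideal.mem_iInf]
  refine ⟨fun hg j m hm => mem_colonExponents_of_mem_colon p e hirr ?_ j hm, fun hg f hf => ?_⟩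
  · simpa only [Ideal.mem_iInf] using hg
  · refine mem_frobPow_iInf_faceIdeal fun m hm j => ?_
    rw [coeff_mul] at hm
    obtain ⟨x, hx, hne⟩ := Finset.exists_ne_zero_of_sum_ne_zero hm
    have hsum : x.1 + x.2 = m := Finset.HasAntidiagonal.mem_antidiagonal.mp hx
    rcases hg j x.1 (left_ne_zero_of_mul hne) with h | h
    · exact isUpperSet_faceExponents _ _ (hsum ▸ le_self_add) h
    · obtain ⟨i, hi, hxi⟩ := mem_iInf_faceIdeal.mp (Ideal.mem_iInf.mpr hf) j x.2
        (right_ne_zero_of_mul hne)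
      have := h i hi
      exact ⟨i, hi, by rw [← hsum, Finsupp.add_apply]; omega⟩

end
end
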